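/- Let S be a finite set of primes containing S₀ and let ℓ be a positive integer with ℓ ≥ 2ℓ₀. Then for every integer N ≥ 1, the number of integers n ∈ {1, …, N} such that f(n) ≠ 0 and ord_p(f(n)) > ℓ for some prime p ∈ S is at most d·ζ(ℓ+1−ℓ₀)·N + d|S|, where ζ(k) = Σ_{m=1}^{∞} m^{−k} (note ℓ+1−ℓ₀ ≥ 2 under the stated hypotheses). -/

import Mathlib

open Polynomial
open scoped Classical

/-- `λ_i(p) = ord_p(f'(γ_i))`, where `f'` is the derivative of `f` and `γ_i` is the `i`-th
rational root of `f`. -/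
noncomputable def lamI (f : Polynomial ℤ) {d : ℕ} (γ : Fin d → ℚ) (i : Fin d) (p : ℕ) : ℤ :=
  padicValRat p (((f.map (Int.castRingHom ℚ)).derivative).eval (γ i))

/-- `λ(p) = max_{1 ≤ i ≤ d} λ_i(p)`. -/
noncomputable def lam (f : Polynomial ℤ) {d : ℕ} (hd : 1 ≤ d) (γ : Fin d → ℚ) (p : ℕ) : ℤ :=
  Finset.univ.sup' ⟨⟨0, hd⟩, Finset.mem_univ _⟩ fun i => lamI f γ i p

/-- The Riemann zeta value `ζ(k) = Σ_{m=1}^∞ m^{-k}` for a natural number argument. -/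
noncomputable def zetaVal (k : ℕ) : ℝ :=
  ∑' m : ℕ, 1 / ((m : ℝ) + 1) ^ k

lemma padicValRat_prod {p : ℕ} [Fact p.Prime] {ι : Type*} (s : Finset ι) (g : ι → ℚ)
    (hg : ∀ i ∈ s, g i ≠ 0) :
    padicValRat p (∏ i ∈ s, g i) = ∑ i ∈ s, padicValRat p (g i) := by
  induction s using Finset.induction_on with
  | empty => simp
  | insert a s ha ih =>
    rw [Finset.prod_insert ha, Finset.sum_insert ha, padicValRat.mul (hg a (by simp))
      (Finset.prod_ne_zero_iff.mpr fun i hi => hg i (by simp [hi])),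
      ih fun i hi => hg i (by simp [hi])]

lemma min_le_padicValRat_sub {p : ℕ} [Fact p.Prime] {q r : ℚ} (h : q - r ≠ 0) :
    min (padicValRat p q) (padicValRat p r) ≤ padicValRat p (q - r) := by
  rw [sub_eq_add_neg] at h ⊢
  simpa using padicValRat.min_le_padicValRat_add (p := p) h

lemma injective_of_squarefree_C_mul_prod_X_sub_C {ι K : Type*} [Fintype ι] [Field K] (c : K)
    (γ : ι → K) (h : Squarefree (C c * ∏ i, (X - C (γ i)))) : Function.Injective γ := by
  intro i j hij
  by_contra hne
  refine not_isUnit_X_sub_C (γ i) (h _ (Dvd.dvd.mul_left ?_ _))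
  rw [← Finset.mul_prod_erase _ _ (Finset.mem_univ i)]
  refine mul_dvd_mul_left _ ?_
  rw [hij]
  exact Finset.dvd_prod_of_mem (fun i => X - C (γ i)) (by simp [Ne.symm hne])

lemma eval_derivative_C_mul_prod_X_sub_C {ι K : Type*} [Fintype ι] [Field K] (c : K)
    (γ : ι → K) (i : ι) :
    (C c * ∏ j, (X - C (γ j))).derivative.eval (γ i) =
      c * ∏ j ∈ Finset.univ.erase i, (γ i - γ j) := by
  rw [← Finset.mul_prod_erase _ _ (Finset.mem_univ i)]
  simp [derivative_mul, eval_prod]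

/-- A point `x` at which a split polynomial has large valuation is close to the nearest root:
`ord_p(f(x)) ≤ ord_p(x - γ_i) + ord_p(f'(γ_i))` for some root `γ_i`. -/
lemma exists_padicValRat_eval_le {p : ℕ} [Fact p.Prime] {ι : Type*} [Fintype ι] [Nonempty ι]
    {c : ℚ} (hc : c ≠ 0) {γ : ι → ℚ} (hγ : Function.Injective γ) {x : ℚ}
    (hx : ∀ i, x - γ i ≠ 0) :
    ∃ i, padicValRat p ((C c * ∏ j, (X - C (γ j))).eval x) ≤ padicValRat p (x - γ i) +
      padicValRat p ((C c * ∏ j, (X - C (γ j))).derivative.eval (γ i)) := by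
  obtain ⟨i, hi⟩ := Finite.exists_max fun i => padicValRat p (x - γ i)
  refine ⟨i, ?_⟩
  have hne : ∀ j ∈ Finset.univ.erase i, γ i - γ j ≠ 0 := fun j hj =>
    sub_ne_zero.mpr fun h => (Finset.ne_of_mem_erase hj) (hγ h).symm
  have heval : (C c * ∏ j, (X - C (γ j))).eval x = c * ∏ j, (x - γ j) := by
    simp [eval_prod]
  rw [eval_derivative_C_mul_prod_X_sub_C, heval,
    padicValRat.mul hc (Finset.prod_ne_zero_iff.mpr fun j _ => hx j),
    padicValRat.mul hc (Finset.prod_ne_zero_iff.mpr hne),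
    padicValRat_prod _ _ fun j _ => hx j, padicValRat_prod _ _ hne,
    ← Finset.add_sum_erase _ _ (Finset.mem_univ i)]
  have hsum : ∑ j ∈ Finset.univ.erase i, padicValRat p (x - γ j) ≤
      ∑ j ∈ Finset.univ.erase i, padicValRat p (γ i - γ j) := by
    refine Finset.sum_le_sum fun j hj => ?_
    have h : (x - γ j) - (x - γ i) = γ i - γ j := by ring
    have hmin := min_le_padicValRat_sub (p := p) (h ▸ hne j hj)
    rwa [h, min_eq_left (hi j)] at hmin
  linarith

lemma card_Icc_filter_modEq_le (N q v : ℕ) (hq : 0 < q) :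
    (((Finset.Icc 1 N).filter fun n => n ≡ v [MOD q]).card : ℝ) ≤ N / q + 1 := by
  have hcard : ((((Finset.Icc 1 N).filter fun n => n ≡ v [MOD q]).card : ℤ) : ℚ) ≤
      N / q + 1 := by
    have h := Nat.Ioc_filter_modEq_card 0 N hq v
    rw [show Finset.Icc 1 N = Finset.Ioc 0 N from Finset.Icc_succ_left_eq_Ioc 0 N,
      Finset.filter_congr_decidable, h, Int.cast_max, Int.cast_sub, Int.cast_zero]
    refine max_le ?_ (by positivity)
    have hN := Int.floor_le (((N : ℚ) - v) / q)
    have h0 := Int.lt_floor_add_one ((((0 : ℕ) : ℚ) - v) / q)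
    have hdiff : ((N : ℚ) - v) / q - (((0 : ℕ) : ℚ) - v) / q = N / q := by
      rw [← sub_div]; simp
    linarith
  simpa using (Rat.cast_le (K := ℝ)).mpr hcard

/-- The integers of `{1, …, N}` within `p`-adic distance `p ^ (-k)` of `γ` lie in one residue
class modulo `p ^ k`. -/
lemma card_Icc_filter_le_padicValRat_sub_le {p : ℕ} [Fact p.Prime] (γ : ℚ) (k N : ℕ) :
    (((Finset.Icc 1 N).filter fun n : ℕ => (k : ℤ) ≤ padicValRat p (n - γ)).card : ℝ) ≤
      N / (p : ℝ) ^ k + 1 := by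
  have hp : p.Prime := Fact.out
  rcases ((Finset.Icc 1 N).filter fun n : ℕ =>
      (k : ℤ) ≤ padicValRat p (n - γ)).eq_empty_or_nonempty with h | ⟨m, hm⟩
  · rw [h]
    simp only [Finset.card_empty, Nat.cast_zero]
    positivity
  · have hmk := (Finset.mem_filter.mp hm).2
    have hsub : ((Finset.Icc 1 N).filter fun n : ℕ => (k : ℤ) ≤ padicValRat p (n - γ)) ⊆
        (Finset.Icc 1 N).filter fun n => n ≡ m [MOD p ^ k] := by
      intro n hn
      rw [Finset.mem_filter] at hn ⊢
      refine ⟨hn.1, (Nat.modEq_iff_dvd.mpr ?_)⟩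
      rw [Nat.cast_pow, padicValInt_dvd_iff]
      by_cases hmn : (m : ℤ) - n = 0
      · exact Or.inl hmn
      · right
        have hcast : ((m : ℚ) - γ) - (n - γ) = (((m : ℤ) - n : ℤ) : ℚ) := by
          push_cast; ring
        have hmin := min_le_padicValRat_sub (p := p) (q := m - γ) (r := n - γ)
          (by rw [hcast]; exact_mod_cast hmn)
        rw [hcast, padicValRat.of_int] at hmin
        exact_mod_cast (le_min hmk hn.2).trans hmin
    refine (Nat.cast_le.mpr (Finset.card_le_card hsub)).trans ?_
    exact_mod_cast card_Icc_filter_modEq_le N (p ^ k) m (pow_pos hp.pos k)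

lemma sum_one_div_pow_le_zetaVal {k : ℕ} (hk : 1 < k) (S : Finset ℕ) (hS : ∀ p ∈ S, 0 < p) :
    ∑ p ∈ S, 1 / (p : ℝ) ^ k ≤ zetaVal k := by
  have hsum : Summable fun m : ℕ => 1 / ((m : ℝ) + 1) ^ k := by
    have h := (summable_nat_add_iff 1).mpr (Real.summable_one_div_nat_pow.mpr hk)
    simpa using h
  have hinj : Set.InjOn Nat.pred S := fun a ha b hb hab =>
    Nat.pred_inj (hS a ha) (hS b hb) hab
  calc ∑ p ∈ S, 1 / (p : ℝ) ^ k = ∑ m ∈ S.image Nat.pred, 1 / ((m : ℝ) + 1) ^ k := by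
        rw [Finset.sum_image hinj]
        refine Finset.sum_congr rfl fun p hp => ?_
        have h : p.pred + 1 = p := Nat.succ_pred_eq_of_pos (hS p hp)
        rw [← Nat.cast_succ, Nat.succ_eq_add_one, h]
    _ ≤ zetaVal k := hsum.sum_le_tsum _ fun m _ => by positivity

/-- Let `f ∈ ℤ[T]` be separable of degree `d ≥ 1` with all roots rational,
`S ⊇ S₀` a finite set of primes and `ℓ ≥ 2ℓ₀`. Then for `N ≥ 1`, the number of
`n ∈ {1, …, N}` with `f(n) ≠ 0` and `ord_p(f(n)) > ℓ` for some `p ∈ S` is at most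
`d·ζ(ℓ+1−ℓ₀)·N + d|S|`. -/
theorem count_large_valuation_in_S
    (f : Polynomial ℤ) (d : ℕ) (hd : 1 ≤ d) (hdeg : f.natDegree = d) (hf0 : f ≠ 0)
    (hsep : Squarefree (f.map (Int.castRingHom ℚ)))
    (γ : Fin d → ℚ)
    (hfac : f.map (Int.castRingHom ℚ) =
      Polynomial.C ((f.leadingCoeff : ℚ)) * ∏ i : Fin d, (Polynomial.X - Polynomial.C (γ i)))
    (S : Finset ℕ) (hSp : ∀ p ∈ S, Nat.Prime p)
    (hS0 : ∀ p : ℕ, p.Prime → ((∃ i : Fin d, lamI f γ i p ≠ 0) ∨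
      (∃ i : Fin d, γ i ≠ 0 ∧ padicValRat p (γ i) ≠ 0)) → p ∈ S)
    (ℓ₀ : ℕ) (hℓ₀ub : ∀ p : ℕ, p.Prime → lam f hd γ p ≤ (ℓ₀ : ℤ))
    (hℓ₀max : ∃ p : ℕ, p.Prime ∧ lam f hd γ p = (ℓ₀ : ℤ))
    (ℓ : ℕ) (hℓ1 : 1 ≤ ℓ) (hℓ : 2 * ℓ₀ ≤ ℓ)
    (N : ℕ) (hN : 1 ≤ N) :
    ((((Finset.Icc 1 N).filter fun n : ℕ =>
        f.eval (n : ℤ) ≠ 0 ∧ ∃ p ∈ S, ℓ < padicValInt p (f.eval (n : ℤ))).card : ℝ)) ≤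
      (d : ℝ) * zetaVal (ℓ + 1 - ℓ₀) * N + (d : ℝ) * S.card := by
  have : Nonempty (Fin d) := ⟨⟨0, hd⟩⟩
  have hc : (f.leadingCoeff : ℚ) ≠ 0 := by exact_mod_cast leadingCoeff_ne_zero.mpr hf0
  have hγ : Function.Injective γ :=
    injective_of_squarefree_C_mul_prod_X_sub_C _ γ (hfac ▸ hsep)
  set k := ℓ + 1 - ℓ₀ with hk
  have hk1 : 1 < k := by omega
  have hsub : ((Finset.Icc 1 N).filter fun n : ℕ =>
      f.eval (n : ℤ) ≠ 0 ∧ ∃ p ∈ S, ℓ < padicValInt p (f.eval (n : ℤ))) ⊆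
      S.biUnion fun p => Finset.univ.biUnion fun i => (Finset.Icc 1 N).filter fun n : ℕ =>
        (k : ℤ) ≤ padicValRat p (n - γ i) := by
    intro n hn
    obtain ⟨hnN, hfn, p, hpS, hp⟩ := Finset.mem_filter.mp hn
    have hprime := hSp p hpS
    have : Fact p.Prime := ⟨hprime⟩
    have heval : (f.map (Int.castRingHom ℚ)).eval (n : ℚ) = (f.eval (n : ℤ) : ℤ) := by
      simp
    have hx : ∀ i, (n : ℚ) - γ i ≠ 0 := by
      have h : (f.map (Int.castRingHom ℚ)).eval (n : ℚ) ≠ 0 := by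
        rw [heval]; exact_mod_cast hfn
      rw [hfac, eval_mul, eval_prod] at h
      intro i
      simpa using Finset.prod_ne_zero_iff.mp (right_ne_zero_of_mul h) i (Finset.mem_univ i)
    obtain ⟨i, hi⟩ := exists_padicValRat_eval_le (p := p) hc hγ hx
    rw [← hfac, heval, padicValRat.of_int] at hi
    have hlam : padicValRat p ((f.map (Int.castRingHom ℚ)).derivative.eval (γ i)) ≤ ℓ₀ :=
      (Finset.le_sup' (fun i => lamI f γ i p) (Finset.mem_univ i)).trans (hℓ₀ub p hprime)
    simp only [Finset.mem_biUnion, Finset.mem_univ, true_and, Finset.mem_filter]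
    exact ⟨p, hpS, i, hnN, by omega⟩
  calc _ ≤ ∑ p ∈ S, ∑ i : Fin d, (((Finset.Icc 1 N).filter fun n : ℕ =>
        (k : ℤ) ≤ padicValRat p (n - γ i)).card : ℝ) := by
        exact_mod_cast (Finset.card_le_card hsub).trans (Finset.card_biUnion_le.trans
          (Finset.sum_le_sum fun p _ => Finset.card_biUnion_le))
    _ ≤ ∑ p ∈ S, ∑ i : Fin d, (N / (p : ℝ) ^ k + 1) := by
        refine Finset.sum_le_sum fun p hp => Finset.sum_le_sum fun i _ => ?_
        have : Fact p.Prime := ⟨hSp p hp⟩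
        exact card_Icc_filter_le_padicValRat_sub_le (γ i) k N
    _ = d * (∑ p ∈ S, 1 / (p : ℝ) ^ k) * N + d * S.card := by
        simp only [Finset.sum_const, Finset.card_univ, Fintype.card_fin, nsmul_eq_mul,
          ← Finset.mul_sum, Finset.sum_add_distrib, div_eq_mul_inv, one_mul]
        ring
    _ ≤ d * zetaVal k * N + d * S.card := by
        gcongr
        exact sum_one_div_pow_le_zetaVal hk1 S fun p hp => (hSp p hp).pos
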